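/- Let the family (μ^(k)) be in the mean Nevai class M^(C,1)(Σ_{la,lb}) for the arithmetic-mean weights σ_{n,k} = 1/(n+1), with limits Σ_{la,lb} = 0 for la ≥ 1 and Σ_{0,lb} = Γ(3/2) Γ(lb/2 + 1) / ( 2^{lb} Γ(lb/2 + 3/2) ). Then the equilibrium measure is the uniform probability measure on [−1,1]: for every bounded continuous function f : ℝ → ℝ, lim_{n→∞} (1/(n+1)) Σ_{k=0}^n ∫_ℝ f(x) (p_k^(n−k)(x))² dμ^(n−k)(x) = (1/2) ∫_{−1}^1 f(x) dx, and lim_{n→∞} Σ_{k=0}^n Σ_{j=1}^{k+1} 2 f(x_{k+1,j}^(n−k)) / ( (n+1)(n+2) ) = (1/2) ∫_{−1}^1 f(x) dx, where x_{k+1,j}^(n−k) are the roots of p_{k+1}^(n−k). -/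

import Mathlib

open Filter MeasureTheory Finset Topology

/-- The entry `(i, l)` of the `m`-th power of the Jacobi matrix with diagonal `a` and
off-diagonal `b`. -/
def jacobiPow (a b : ℕ → ℝ) : ℕ → ℕ → ℕ → ℝ
  | 0, i, l => if i = l then 1 else 0
  | m + 1, i, l => b (i + 1) * jacobiPow a b m (i + 1) l + a i * jacobiPow a b m i l +
      b i * jacobiPow a b m (i - 1) l

/-- The number of simple walks of length `m` on `ℤ` with total displacement `d`. -/
def walkCount : ℕ → ℤ → ℝ
  | 0, d => if d = 0 then 1 else 0
  | m + 1, d => walkCount m (d + 1) + walkCount m (d - 1)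

lemma walkCount_eq_zero_of_lt (m : ℕ) : ∀ d : ℤ, d < -m → walkCount m d = 0 := by
  induction m with
  | zero => intro d hd; simp only [walkCount]; rw [if_neg]; push_cast at hd; omega
  | succ m ih =>
    intro d hd
    push_cast at hd
    simp only [walkCount]
    rw [ih _ (by omega), ih _ (by omega), add_zero]

lemma walkCount_eq_zero_of_odd (m : ℕ) : ∀ d : ℤ, Odd (m + d) → walkCount m d = 0 := by
  induction m with
  | zero =>
    intro d hd
    simp only [walkCount]
    rw [if_neg]
    rintro rfl
    simp at hd
  | succ m ih =>
    intro d hd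
    obtain ⟨r, hr⟩ := hd
    push_cast at hr
    simp only [walkCount]
    rw [ih _ ⟨r, by omega⟩, ih _ ⟨r - 1, by omega⟩, add_zero]

lemma walkCount_eq_choose (m : ℕ) : ∀ s : ℕ, walkCount m (2 * s - m) = m.choose s := by
  induction m with
  | zero =>
    intro s
    rcases s with _ | s
    · simp [walkCount]
    · simp only [walkCount]
      rw [if_neg (by push_cast; omega)]
      simp
  | succ m ih =>
    intro s
    have e : (2 * s - (m + 1 : ℕ) : ℤ) + 1 = 2 * s - m := by push_cast; ring
    simp only [walkCount]
    rw [e, ih s]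
    rcases s with _ | s
    · rw [walkCount_eq_zero_of_lt m _ (by push_cast; omega)]
      simp
    · have e' : (2 * (s + 1 : ℕ) - (m + 1 : ℕ) : ℤ) - 1 = 2 * s - m := by push_cast; ring
      rw [e', ih s, Nat.choose_succ_succ, Nat.cast_add, add_comm]

lemma abs_jacobiPow_le {a b : ℕ → ℝ} {S : ℝ} (hb : ∀ i, 0 ≤ b i)
    (hS : ∀ i, b (i + 1) + |a i| + b i ≤ S) (m : ℕ) : ∀ i l, |jacobiPow a b m i l| ≤ S ^ m := by
  have hS0 : 0 ≤ S := le_trans (by have := hb 1; have := hb 0; positivity) (hS 0)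
  induction m with
  | zero => intro i l; simp only [jacobiPow]; split_ifs <;> simp
  | succ m ih =>
    intro i l
    simp only [jacobiPow]
    calc |b (i + 1) * jacobiPow a b m (i + 1) l + a i * jacobiPow a b m i l +
          b i * jacobiPow a b m (i - 1) l|
        ≤ b (i + 1) * |jacobiPow a b m (i + 1) l| + |a i| * |jacobiPow a b m i l| +
          b i * |jacobiPow a b m (i - 1) l| := by
          refine (abs_add_three _ _ _).trans (le_of_eq ?_)
          rw [abs_mul, abs_mul, abs_mul, abs_of_nonneg (hb _), abs_of_nonneg (hb _)]
      _ ≤ b (i + 1) * S ^ m + |a i| * S ^ m + b i * S ^ m := by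
          have := hb i
          have := hb (i + 1)
          gcongr <;> apply ih
      _ = (b (i + 1) + |a i| + b i) * S ^ m := by ring
      _ ≤ S * S ^ m := by have := hS i; gcongr
      _ = S ^ (m + 1) := by ring

/-- A linear functional for which `p 0, …, p (N - 1)` are orthonormal has the entries of the
powers of the Jacobi matrix as its matrix elements, as long as they do not feel the cut-off. -/
lemma functional_X_pow_mul_eq_jacobiPow {a b : ℕ → ℝ} {p : ℕ → Polynomial ℝ}
    (hrec : ∀ l, Polynomial.X * p l = Polynomial.C (b (l + 1)) * p (l + 1) +
      Polynomial.C (a l) * p l + Polynomial.C (b l) * p (l - 1))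
    (L : Polynomial ℝ →ₗ[ℝ] ℝ) (N : ℕ)
    (hL : ∀ i l, i < N → l < N → L (p i * p l) = if i = l then 1 else 0) (m : ℕ) :
    ∀ i l, i + m < N → l < N → L (Polynomial.X ^ m * (p i * p l)) = jacobiPow a b m i l := by
  induction m with
  | zero => intro i l hi hl; simpa [jacobiPow] using hL i l hi hl
  | succ m ih =>
    intro i l hi hl
    have h : (Polynomial.X ^ (m + 1) * (p i * p l) : Polynomial ℝ) =
        b (i + 1) • (Polynomial.X ^ m * (p (i + 1) * p l)) +
        a i • (Polynomial.X ^ m * (p i * p l)) +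
        b i • (Polynomial.X ^ m * (p (i - 1) * p l)) := by
      simp only [Polynomial.smul_eq_C_mul]
      linear_combination (Polynomial.X ^ m * p l) * hrec i
    rw [h, map_add, map_add, map_smul, map_smul, map_smul, ih _ _ (by omega) hl,
      ih _ _ (by omega) hl, ih _ _ (by omega) hl]
    simp [jacobiPow]

/-- A double array `u` tends to zero in the mean along its antidiagonals. -/
def MeanNull (u : ℕ → ℕ → ℝ) : Prop :=
  Tendsto (fun n : ℕ => (∑ k ∈ range (n + 1), |u (n - k) k|) / ((n : ℝ) + 1)) atTop (𝓝 0)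

namespace MeanNull

variable {u v : ℕ → ℕ → ℝ}

lemma zero : MeanNull (fun _ _ => 0) := by simp [MeanNull]

lemma add (hu : MeanNull u) (hv : MeanNull v) : MeanNull (fun q k => u q k + v q k) := by
  have h := Tendsto.add hu hv
  rw [add_zero] at h
  refine squeeze_zero (fun n => by positivity) (fun n => ?_) h
  rw [← add_div, ← sum_add_distrib]
  gcongr
  apply abs_add_le

lemma mul_of_abs_le (hu : MeanNull u) {C : ℝ} (hv : ∀ q k, |v q k| ≤ C) :
    MeanNull (fun q k => v q k * u q k) := by
  have h := Tendsto.const_mul C hu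
  rw [mul_zero] at h
  refine squeeze_zero (fun n => by positivity) (fun n => ?_) h
  rw [← mul_div_assoc, mul_sum]
  gcongr
  rw [abs_mul]
  gcongr
  apply hv

lemma pow_sub_pow {C : ℝ} (h : MeanNull (fun q k => u q k - v q k)) (hu : ∀ q k, |u q k| ≤ C)
    (hv : ∀ q k, |v q k| ≤ C) (m : ℕ) : MeanNull (fun q k => u q k ^ m - v q k ^ m) := by
  induction m with
  | zero => simpa using MeanNull.zero
  | succ m ih =>
    have hv' : ∀ q k, |v q k ^ m| ≤ C ^ m := fun q k => by
      rw [abs_pow]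
      gcongr
      exact hv q k
    convert (ih.mul_of_abs_le hu).add (h.mul_of_abs_le hv') using 3
    ring

lemma of_shift_one {C : ℝ} (hC : ∀ q k, |u q k| ≤ C) (h : MeanNull (fun q k => u q (k + 1))) :
    MeanNull u := by
  rw [MeanNull, ← tendsto_add_atTop_iff_nat 1]
  have h1 : Tendsto (fun n : ℕ => C * (1 / ((n : ℝ) + 1))) atTop (𝓝 (C * 0)) :=
    tendsto_one_div_add_atTop_nhds_zero_nat.const_mul C
  have h2 := Tendsto.add h h1
  rw [mul_zero, add_zero] at h2
  have hC0 : 0 ≤ C := (abs_nonneg _).trans (hC 0 0)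
  refine squeeze_zero (fun n => by positivity) (fun n => ?_) h2
  rw [sum_range_succ', mul_one_div, ← add_div]
  simp only [Nat.add_sub_add_right]
  gcongr
  · apply hC
  · linarith

lemma of_shift {C : ℝ} (hC : ∀ q k, |u q k| ≤ C) (l : ℕ)
    (h : MeanNull (fun q k => u q (k + l))) : MeanNull u := by
  induction l with
  | zero => exact h
  | succ l ih =>
    refine ih (of_shift_one (fun q k => hC q _) ?_)
    simpa only [add_right_comm _ 1 l, ← add_assoc] using h

lemma of_sq (h : MeanNull (fun q k => u q k ^ 2)) : MeanNull u := by
  have h1 := (Real.continuous_sqrt.tendsto _).comp h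
  rw [Real.sqrt_zero] at h1
  refine squeeze_zero (fun n => by positivity) (fun n => ?_) h1
  refine Real.le_sqrt_of_sq_le ?_
  have := sq_sum_le_card_mul_sum_sq (s := range (n + 1)) (f := fun k => |u (n - k) k|)
  rw [card_range] at this
  rw [div_pow, div_le_div_iff₀ (by positivity) (by positivity)]
  simp only [sq_abs, abs_sq] at this ⊢
  push_cast at this
  nlinarith [mul_le_mul_of_nonneg_right this (by positivity : (0 : ℝ) ≤ n + 1)]

lemma tendsto_mean (h : MeanNull (fun q k => u q k - v q k)) {x : ℝ}
    (hv : Tendsto (fun n : ℕ => (∑ k ∈ range (n + 1), v (n - k) k) / ((n : ℝ) + 1)) atTop (𝓝 x)) :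
    Tendsto (fun n : ℕ => (∑ k ∈ range (n + 1), u (n - k) k) / ((n : ℝ) + 1)) atTop (𝓝 x) := by
  refine (tendsto_iff_of_dist ?_).mp hv
  refine squeeze_zero (fun n => dist_nonneg) (fun n => ?_) h
  rw [dist_comm, Real.dist_eq, ← sub_div, ← sum_sub_distrib, abs_div,
    abs_of_pos (by positivity : (0 : ℝ) < n + 1)]
  gcongr
  apply abs_sum_le_sum_abs

end MeanNull

/-- In the mean, the powers of a slowly varying Jacobi matrix with null diagonal behave like those
of a Toeplitz matrix. -/
lemma meanNull_jacobiPow_sub {a b : ℕ → ℕ → ℝ} {S : ℝ} (hb : ∀ q i, 0 ≤ b q i)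
    (hS : ∀ q i, b q (i + 1) + |a q i| + b q i ≤ S)
    (ha0 : ∀ i, MeanNull (fun q k => a q (k + i)))
    (hb0 : ∀ i, MeanNull (fun q k => b q (k + i) - b q k)) (m : ℕ) :
    ∀ i l : ℕ, m ≤ i → MeanNull (fun q k =>
      jacobiPow (a q) (b q) m (k + i) (k + l) - walkCount m ((i : ℤ) - l) * b q k ^ m) := by
  induction m with
  | zero =>
    intro i l _
    convert MeanNull.zero using 3 with q k
    simp only [jacobiPow, walkCount, sub_eq_zero, Nat.cast_inj, add_right_inj, pow_zero, mul_one]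
  | succ m ih =>
    intro i l hi
    obtain ⟨i, rfl⟩ : ∃ j, i = j + 1 := ⟨i - 1, by omega⟩
    have hJ : ∀ i q k, |jacobiPow (a q) (b q) m (k + i) (k + l)| ≤ S ^ m :=
      fun i q k => abs_jacobiPow_le (hb q) (hS q) m _ _
    have hbS : ∀ q k, |b q k| ≤ S := fun q k => by
      rw [abs_of_nonneg (hb q k)]
      have := hS q k
      have := hb q (k + 1)
      have := abs_nonneg (a q k)
      linarith
    have h1 := (hb0 (i + 2)).mul_of_abs_le (hJ (i + 2))
    have h2 := (ha0 (i + 1)).mul_of_abs_le (hJ (i + 1))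
    have h3 := (hb0 (i + 1)).mul_of_abs_le (hJ i)
    have h4 := (ih (i + 2) l (by omega)).mul_of_abs_le hbS
    have h5 := (ih i l (by omega)).mul_of_abs_le hbS
    convert ((h1.add h2).add h3).add (h4.add h5) using 3 with q k
    simp only [jacobiPow, walkCount]
    have e1 : ((i + 2 : ℕ) : ℤ) - l = ((i + 1 : ℕ) : ℤ) - l + 1 := by push_cast; ring
    have e2 : (i : ℤ) - l = ((i + 1 : ℕ) : ℤ) - l - 1 := by push_cast; ring
    have e3 : k + (i + 1) - 1 = k + i := by omega
    rw [e1, e2, e3, add_assoc k (i + 1) 1]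
    ring

lemma sum_range_cast_add_one (n : ℕ) :
    ∑ s ∈ range (n + 1), ((s : ℝ) + 1) = (n + 1) * (n + 2) / 2 := by
  induction n with
  | zero => norm_num
  | succ n ih => rw [sum_range_succ, ih]; push_cast; ring

lemma sum_antidiagonal_rearrange (T : ℕ → ℕ → ℝ) (n : ℕ) :
    ∑ k ∈ range (n + 1), ∑ i ∈ range (k + 1), T (n - k) i =
      ∑ s ∈ range (n + 1), ∑ i ∈ range (s + 1), T (s - i) i := by
  induction n with
  | zero => simp
  | succ n ih =>
    rw [sum_range_succ (fun s => ∑ i ∈ range (s + 1), T (s - i) i), ← ih]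
    simp only [sum_range_succ (fun i => T (n + 1 - _) i), sum_add_distrib]
    rw [sum_range_succ' (fun k => ∑ i ∈ range k, T (n + 1 - k) i)]
    simp

lemma tendsto_weighted_mean {M : ℕ → ℝ} {x : ℝ} (h : Tendsto M atTop (𝓝 x)) :
    Tendsto (fun n : ℕ => (∑ s ∈ range (n + 1), ((s : ℝ) + 1) * M s) *
      (2 / (((n : ℝ) + 1) * ((n : ℝ) + 2)))) atTop (𝓝 x) := by
  have h0 : Tendsto (fun n => |M n - x|) atTop (𝓝 0) := by
    simpa using (h.sub_const x).abs
  have h1 := ((tendsto_add_atTop_iff_nat 1).mpr h0.cesaro).const_mul 2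
  rw [mul_zero] at h1
  rw [tendsto_iff_dist_tendsto_zero]
  refine squeeze_zero (fun n => dist_nonneg) (fun n => ?_) h1
  have hx : x = (∑ s ∈ range (n + 1), ((s : ℝ) + 1) * x) * (2 / (((n : ℝ) + 1) * ((n : ℝ) + 2))) := by
    rw [← sum_mul, sum_range_cast_add_one]; field_simp
  rw [Real.dist_eq, show ∀ y : ℝ, |y - x| = |y - (∑ s ∈ range (n + 1), ((s : ℝ) + 1) * x) *
    (2 / (((n : ℝ) + 1) * ((n : ℝ) + 2)))| from fun y => by rw [← hx], ← sub_mul, ← sum_sub_distrib, abs_mul,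
    abs_of_pos (by positivity : (0 : ℝ) < 2 / (((n : ℝ) + 1) * ((n : ℝ) + 2)))]
  have h2 : |∑ s ∈ range (n + 1), (((s : ℝ) + 1) * M s - ((s : ℝ) + 1) * x)| ≤
      (n + 1) * ∑ s ∈ range (n + 1), |M s - x| := by
    refine (abs_sum_le_sum_abs _ _).trans ?_
    rw [mul_sum]
    refine sum_le_sum fun s hs => ?_
    rw [← mul_sub, abs_mul, abs_of_pos (by positivity : (0 : ℝ) < (s : ℝ) + 1)]
    have : (s : ℝ) ≤ n := by exact_mod_cast Nat.lt_succ_iff.mp (mem_range.mp hs)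
    gcongr
  calc _ ≤ ((n + 1) * ∑ s ∈ range (n + 1), |M s - x|) * (2 / (((n : ℝ) + 1) * ((n : ℝ) + 2))) := by
        gcongr
    _ = 2 * (((n : ℝ) + 2)⁻¹ * ∑ s ∈ range (n + 1), |M s - x|) := by field_simp
    _ ≤ _ := by
        push_cast
        gcongr
        linarith

lemma centralBinom_mul_gamma (r : ℕ) :
    (r.centralBinom : ℝ) * (Real.Gamma (3 / 2) * Real.Gamma (r + 1) /
      (2 ^ (2 * r) * Real.Gamma (r + 3 / 2))) = 1 / (2 * r + 1) := by
  have h3 : Real.Gamma (3 / 2) ≠ 0 := (Real.Gamma_pos_of_pos (by norm_num)).ne'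
  induction r with
  | zero => simp [h3]
  | succ r ih =>
    have hc : ((r : ℝ) + 1) * ((r + 1).centralBinom : ℝ) = 2 * (2 * r + 1) * r.centralBinom := by
      exact_mod_cast Nat.succ_mul_centralBinom_succ r
    have hg : Real.Gamma ((r : ℝ) + 3 / 2) ≠ 0 := (Real.Gamma_pos_of_pos (by positivity)).ne'
    push_cast
    rw [Real.Gamma_add_one (by positivity : (r : ℝ) + 1 ≠ 0),
      show (r : ℝ) + 1 + 3 / 2 = r + 3 / 2 + 1 by ring,
      Real.Gamma_add_one (by positivity : (r : ℝ) + 3 / 2 ≠ 0)]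
    have : ((r + 1).centralBinom : ℝ) = 2 * (2 * r + 1) * r.centralBinom / (r + 1) := by
      rw [← hc]; field_simp
    rw [this]
    field_simp at ih ⊢
    have e : (2 : ℝ) ^ (2 * (r + 1)) = 4 * 2 ^ (2 * r) := by ring
    rw [e]
    linear_combination (4 * (2 * (r : ℝ) + 3)) * ih

lemma walkCount_zero_mul_gamma (m : ℕ) :
    walkCount m 0 * (Real.Gamma (3 / 2) * Real.Gamma ((m : ℝ) / 2 + 1) /
      (2 ^ m * Real.Gamma ((m : ℝ) / 2 + 3 / 2))) = 1 / 2 * ∫ x in (-1 : ℝ)..1, x ^ m := by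
  rw [integral_pow]
  rcases Nat.even_or_odd m with ⟨r, rfl⟩ | hm
  · have h1 := walkCount_eq_choose (r + r) r
    rw [show (2 * r - (r + r : ℕ) : ℤ) = 0 by push_cast; ring, ← two_mul,
      ← Nat.centralBinom_eq_two_mul_choose] at h1
    have h2 := centralBinom_mul_gamma r
    rw [← two_mul, h1]
    push_cast
    rw [show (2 * r : ℝ) / 2 = r by ring, h2, Odd.neg_one_pow ⟨r, rfl⟩]
    field_simp
    ring
  · rw [walkCount_eq_zero_of_odd m 0 (by simpa using hm), Even.neg_one_pow (Odd.add_one hm)]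
    simp

section Gauss

variable {a b : ℕ → ℝ} {p : ℕ → Polynomial ℝ}

lemma eval_three_term
    (hrec : ∀ l, Polynomial.X * p l = Polynomial.C (b (l + 1)) * p (l + 1) +
      Polynomial.C (a l) * p l + Polynomial.C (b l) * p (l - 1)) (l : ℕ) (x : ℝ) :
    x * (p l).eval x = b (l + 1) * (p (l + 1)).eval x + a l * (p l).eval x +
      b l * (p (l - 1)).eval x := by
  simpa using congrArg (Polynomial.eval x) (hrec l)

lemma christoffel_darboux
    (hrec : ∀ l, Polynomial.X * p l = Polynomial.C (b (l + 1)) * p (l + 1) +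
      Polynomial.C (a l) * p l + Polynomial.C (b l) * p (l - 1)) (x y : ℝ) (n : ℕ) :
    (x - y) * ∑ i ∈ range (n + 1), (p i).eval x * (p i).eval y =
      b (n + 1) * ((p (n + 1)).eval x * (p n).eval y - (p n).eval x * (p (n + 1)).eval y) := by
  induction n with
  | zero =>
    have hx := eval_three_term hrec 0 x
    have hy := eval_three_term hrec 0 y
    simp only [zero_add, zero_tsub, sum_range_one] at hx hy ⊢
    linear_combination (p 0).eval y * hx - (p 0).eval x * hy
  | succ n ih =>
    have hx := eval_three_term hrec (n + 1) x
    have hy := eval_three_term hrec (n + 1) y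
    rw [sum_range_succ, mul_add, ih]
    simp only [Nat.add_sub_cancel] at hx hy
    linear_combination (p (n + 1)).eval y * hx - (p (n + 1)).eval x * hy

/-- The roots of `p (n + 1)` obey the Gershgorin bound. -/
lemma abs_root_le {S : ℝ} (hb : ∀ i, 0 ≤ b i)
    (hS : ∀ i, b (i + 1) + |a i| + b i ≤ S)
    (hrec : ∀ l, Polynomial.X * p l = Polynomial.C (b (l + 1)) * p (l + 1) +
      Polynomial.C (a l) * p l + Polynomial.C (b l) * p (l - 1))
    {n : ℕ} {x : ℝ} (hp0 : (p 0).eval x ≠ 0) (hx : (p (n + 1)).eval x = 0) : |x| ≤ S := by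
  obtain ⟨i, hi, hmax⟩ := exists_max_image (range (n + 1)) (fun i => |(p i).eval x|) ⟨0, by simp⟩
  have hpos : 0 < |(p i).eval x| := (abs_pos.mpr hp0).trans_le (hmax 0 (by simp))
  have hsucc : |(p (i + 1)).eval x| ≤ |(p i).eval x| := by
    rcases eq_or_ne i n with rfl | hne
    · rw [hx, abs_zero]; exact hpos.le
    · exact hmax _ (by simp at hi ⊢; omega)
  have hpred : |(p (i - 1)).eval x| ≤ |(p i).eval x| := hmax _ (by simp at hi ⊢; omega)
  refine le_of_mul_le_mul_right ?_ hpos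
  rw [← abs_mul, eval_three_term hrec]
  have := hb i
  have := hb (i + 1)
  calc _ ≤ b (i + 1) * |(p (i + 1)).eval x| + |a i| * |(p i).eval x| +
          b i * |(p (i - 1)).eval x| := by
        refine (abs_add_three _ _ _).trans (le_of_eq ?_)
        rw [abs_mul, abs_mul, abs_mul, abs_of_nonneg (hb _), abs_of_nonneg (hb _)]
    _ ≤ b (i + 1) * |(p i).eval x| + |a i| * |(p i).eval x| + b i * |(p i).eval x| := by gcongr
    _ = (b (i + 1) + |a i| + b i) * |(p i).eval x| := by ring
    _ ≤ _ := by have := hS i; gcongr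

/-- The reciprocal of the Gauss weight of `p (n + 1)` at the node `x`. -/
def christoffelSum (p : ℕ → Polynomial ℝ) (n : ℕ) (x : ℝ) : ℝ :=
  ∑ i ∈ range (n + 1), (p i).eval x * (p i).eval x

lemma christoffelSum_pos {n : ℕ} {x : ℝ} (hp0 : (p 0).eval x ≠ 0) : 0 < christoffelSum p n x :=
  sum_pos' (fun _ _ => mul_self_nonneg _) ⟨0, by simp, mul_self_pos.mpr hp0⟩

/-- Gauss quadrature at the nodes `x`. -/
noncomputable def gaussQuadrature (p : ℕ → Polynomial ℝ) (n : ℕ) (x : Fin (n + 1) → ℝ) :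
    Polynomial ℝ →ₗ[ℝ] ℝ :=
  ∑ j, (christoffelSum p n (x j))⁻¹ • Polynomial.leval (x j)

lemma gaussQuadrature_apply {n : ℕ} (x : Fin (n + 1) → ℝ) (q : Polynomial ℝ) :
    gaussQuadrature p n x q = ∑ j, (christoffelSum p n (x j))⁻¹ * q.eval (x j) := by
  simp [gaussQuadrature, LinearMap.sum_apply]

lemma gaussQuadrature_orthonormal
    (hrec : ∀ l, Polynomial.X * p l = Polynomial.C (b (l + 1)) * p (l + 1) +
      Polynomial.C (a l) * p l + Polynomial.C (b l) * p (l - 1))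
    {n : ℕ} {x : Fin (n + 1) → ℝ} (hxi : Function.Injective x)
    (hp0 : ∀ y, (p 0).eval y ≠ 0) (hx : ∀ j, (p (n + 1)).eval (x j) = 0)
    (i l : ℕ) (hi : i < n + 1) (hl : l < n + 1) :
    gaussQuadrature p n x (p i * p l) = if i = l then 1 else 0 := by
  let U : Matrix (Fin (n + 1)) (Fin (n + 1)) ℝ := fun j i => (p i).eval (x j)
  let V : Matrix (Fin (n + 1)) (Fin (n + 1)) ℝ :=
    fun i j => (p i).eval (x j) * (christoffelSum p n (x j))⁻¹
  have hUV : U * V = 1 := by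
    ext j k
    rw [Matrix.mul_apply]
    have h1 : ∑ i, U j i * V i k =
        (∑ i ∈ range (n + 1), (p i).eval (x j) * (p i).eval (x k)) *
          (christoffelSum p n (x k))⁻¹ := by
      rw [← Fin.sum_univ_eq_sum_range (fun i => (p i).eval (x j) * (p i).eval (x k)), sum_mul]
      exact sum_congr rfl fun i _ => (mul_assoc _ _ _).symm
    rw [h1]
    rcases eq_or_ne j k with rfl | hjk
    · rw [Matrix.one_apply_eq]
      exact mul_inv_cancel₀ (christoffelSum_pos (hp0 _)).ne'
    · rw [Matrix.one_apply_ne hjk]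
      have h2 := christoffel_darboux hrec (x j) (x k) n
      rw [hx, hx, zero_mul, mul_zero, sub_zero, mul_zero] at h2
      rw [(mul_eq_zero.mp h2).resolve_left (sub_ne_zero.mpr (hxi.ne hjk)), zero_mul]
  have hVU : V * U = 1 := mul_eq_one_comm.mp hUV
  have h := congrFun (congrFun hVU ⟨i, hi⟩) ⟨l, hl⟩
  rw [Matrix.mul_apply, Matrix.one_apply] at h
  simp only [Fin.mk.injEq] at h
  rw [gaussQuadrature_apply, ← h]
  refine sum_congr rfl fun j _ => ?_
  simp only [U, V, Polynomial.eval_mul]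
  ring

lemma abs_gaussQuadrature_le {S : ℝ} {n : ℕ} {x : Fin (n + 1) → ℝ}
    (hp0 : ∀ y, (p 0).eval y ≠ 0) (hxS : ∀ j, |x j| ≤ S) (q : Polynomial ℝ) (m : ℕ) :
    |gaussQuadrature p n x (Polynomial.X ^ m * (q * q))| ≤
      S ^ m * gaussQuadrature p n x (q * q) := by
  rw [gaussQuadrature_apply, gaussQuadrature_apply, mul_sum]
  refine (abs_sum_le_sum_abs _ _).trans (sum_le_sum fun j _ => ?_)
  have h := (christoffelSum_pos (n := n) (hp0 (x j))).le
  simp only [Polynomial.eval_mul, Polynomial.eval_pow, Polynomial.eval_X]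
  rw [abs_mul, abs_mul, abs_mul_self, abs_pow, abs_of_nonneg (inv_nonneg.mpr h), mul_left_comm]
  have := mul_self_nonneg (q.eval (x j))
  have := inv_nonneg.mpr h
  gcongr
  apply hxS

/-- The power sums of the roots of `p (n + 1)` are, up to a boundary term, the traces of the
truncated powers of the Jacobi matrix. -/
lemma abs_sum_root_pow_sub_le {S : ℝ} (hb : ∀ i, 0 ≤ b i)
    (hS : ∀ i, b (i + 1) + |a i| + b i ≤ S)
    (hrec : ∀ l, Polynomial.X * p l = Polynomial.C (b (l + 1)) * p (l + 1) +
      Polynomial.C (a l) * p l + Polynomial.C (b l) * p (l - 1))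
    {n : ℕ} {x : Fin (n + 1) → ℝ} (hxi : Function.Injective x)
    (hp0 : ∀ y, (p 0).eval y ≠ 0) (hx : ∀ j, (p (n + 1)).eval (x j) = 0) (m : ℕ) :
    |∑ j, x j ^ m - ∑ i ∈ range (n + 1), jacobiPow a b m i i| ≤ m * (2 * S ^ m) := by
  have horth := gaussQuadrature_orthonormal hrec hxi hp0 hx
  have hxS : ∀ j, |x j| ≤ S := fun j => abs_root_le hb hS hrec (hp0 _) (hx j)
  have hS0 : 0 ≤ S := (abs_nonneg _).trans (hxS 0)
  have h1 : ∑ j, x j ^ m =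
      ∑ i ∈ range (n + 1), gaussQuadrature p n x (Polynomial.X ^ m * (p i * p i)) := by
    simp only [gaussQuadrature_apply]
    rw [sum_comm]
    refine sum_congr rfl fun j _ => ?_
    simp only [Polynomial.eval_mul, Polynomial.eval_pow, Polynomial.eval_X]
    rw [← mul_sum, ← mul_sum]
    have h := (christoffelSum_pos (n := n) (hp0 (x j))).ne'
    change _ = _ * (_ * christoffelSum p n (x j))
    field_simp
  rw [h1, ← sum_sub_distrib]
  refine (abs_sum_le_sum_abs _ _).trans ?_
  have h2 : ∀ i ∈ range (n + 1),
      |gaussQuadrature p n x (Polynomial.X ^ m * (p i * p i)) - jacobiPow a b m i i| ≤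
        if i + m < n + 1 then 0 else 2 * S ^ m := by
    intro i hi
    rw [mem_range] at hi
    split_ifs with h
    · rw [functional_X_pow_mul_eq_jacobiPow hrec _ (n + 1) horth m i i h hi, sub_self, abs_zero]
    · have h3 := abs_gaussQuadrature_le hp0 hxS (p i) m
      rw [horth i i hi hi, if_pos rfl, mul_one] at h3
      have h4 := abs_jacobiPow_le hb hS m i i
      have := abs_sub (gaussQuadrature p n x (Polynomial.X ^ m * (p i * p i)))
        (jacobiPow a b m i i)
      linarith
  refine (sum_le_sum h2).trans ?_
  rw [sum_ite, sum_const_zero, zero_add, sum_const, nsmul_eq_mul]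
  gcongr
  calc _ ≤ (Ico (n + 1 - m) (n + 1)).card := card_le_card fun i hi => by
        simp at hi ⊢; omega
    _ ≤ m := by simp; omega

end Gauss

/-- A sequence of functionals of norm at most one on `C([-S, S])` whose moments converge to those
of the uniform probability measure on `[-1, 1]` converges to it weakly. -/
lemma tendsto_uniform_of_moments {S : ℝ} (hS : 1 ≤ S) (Λ : ℕ → C(ℝ, ℝ) →ₗ[ℝ] ℝ)
    (hΛ : ∀ n f ε, (∀ x ∈ Set.Icc (-S) S, |f x| ≤ ε) → |Λ n f| ≤ ε)
    (hmom : ∀ m : ℕ, Tendsto (fun n => Λ n (ContinuousMap.id ℝ ^ m)) atTop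
      (𝓝 (1 / 2 * ∫ x in (-1 : ℝ)..1, x ^ m))) (f : C(ℝ, ℝ)) :
    Tendsto (fun n => Λ n f) atTop (𝓝 (1 / 2 * ∫ x in (-1 : ℝ)..1, f x)) := by
  have hpoly : ∀ q : Polynomial ℝ, Tendsto (fun n => Λ n q.toContinuousMap) atTop
      (𝓝 (1 / 2 * ∫ x in (-1 : ℝ)..1, q.eval x)) := by
    intro q
    induction q using Polynomial.induction_on' with
    | add q r hq hr =>
      have e : (q + r).toContinuousMap = q.toContinuousMap + r.toContinuousMap := by ext; simp
      simp only [e, map_add, Polynomial.eval_add]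
      rw [intervalIntegral.integral_add (q.continuous.intervalIntegrable _ _)
        (r.continuous.intervalIntegrable _ _), mul_add]
      exact hq.add hr
    | monomial m c =>
      have e : (Polynomial.monomial m c).toContinuousMap = c • ContinuousMap.id ℝ ^ m := by
        ext; simp
      simp only [e, map_smul, Polynomial.eval_monomial, smul_eq_mul]
      rw [intervalIntegral.integral_const_mul, mul_left_comm]
      exact (hmom m).const_mul c
  rw [Metric.tendsto_atTop]
  intro ε hε
  obtain ⟨q, hq⟩ := exists_polynomial_near_of_continuousOn (-S) S f f.continuous.continuousOn
    (ε / 3) (by positivity)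
  obtain ⟨n₀, hn₀⟩ := Metric.tendsto_atTop.mp (hpoly q) (ε / 3) (by positivity)
  refine ⟨n₀, fun n hn => ?_⟩
  have h1 := hn₀ n hn
  have h2 := hΛ n (q.toContinuousMap - f) (ε / 3) fun x hx => by simpa using (hq x hx).le
  rw [map_sub] at h2
  have h3 : ‖∫ x in (-1 : ℝ)..1, (q.eval x - f x)‖ ≤ ε / 3 * |1 - (-1)| :=
    intervalIntegral.norm_integral_le_of_norm_le_const fun x hx => by
      rw [Set.uIoc_of_le (by norm_num)] at hx
      exact (hq x ⟨by linarith [hx.1], by linarith [hx.2]⟩).le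
  rw [intervalIntegral.integral_sub (q.continuous.intervalIntegrable _ _)
    (f.continuous.intervalIntegrable _ _), Real.norm_eq_abs] at h3
  norm_num at h3
  rw [Real.dist_eq] at h1 ⊢
  rw [abs_lt] at h1 ⊢
  rw [abs_le] at h2 h3
  constructor <;> linarith [h1.1, h1.2, h2.1, h2.2, h3.1, h3.2]

section Integral

variable {μ : Measure ℝ} [IsFiniteMeasure μ] {S : ℝ}

lemma integrable_of_continuous_of_support (hμ : μ (Set.Icc (-S) S)ᶜ = 0) {f : ℝ → ℝ}
    (hf : Continuous f) : Integrable f μ := by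
  obtain ⟨C, hC⟩ := (isCompact_Icc (a := -S) (b := S)).exists_bound_of_continuousOn hf.continuousOn
  refine Integrable.of_bound hf.aestronglyMeasurable C ?_
  have : ∀ᵐ x ∂μ, x ∈ Set.Icc (-S) S := hμ
  filter_upwards [this] with x hx using hC x hx

/-- Integration of `f * w` against a finite measure with bounded support. -/
noncomputable def integralMul (hμ : μ (Set.Icc (-S) S)ᶜ = 0) (w : C(ℝ, ℝ)) :
    C(ℝ, ℝ) →ₗ[ℝ] ℝ where
  toFun f := ∫ x, f x * w x ∂μ
  map_add' f g := by
    simp only [ContinuousMap.add_apply, add_mul]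
    exact integral_add (integrable_of_continuous_of_support hμ (by fun_prop))
      (integrable_of_continuous_of_support hμ (by fun_prop))
  map_smul' c f := by
    simp only [ContinuousMap.smul_apply, smul_eq_mul, mul_assoc, integral_const_mul,
      RingHom.id_apply]

lemma abs_integralMul_le (hμ : μ (Set.Icc (-S) S)ᶜ = 0) {w : C(ℝ, ℝ)} (hw : ∀ x, 0 ≤ w x)
    (hw1 : ∫ x, w x ∂μ = 1) (f : C(ℝ, ℝ)) (ε : ℝ) (hf : ∀ x ∈ Set.Icc (-S) S, |f x| ≤ ε) :
    |integralMul hμ w f| ≤ ε := by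
  have : ∀ᵐ x ∂μ, x ∈ Set.Icc (-S) S := hμ
  have h : ‖∫ x, f x * w x ∂μ‖ ≤ ∫ x, ε * w x ∂μ := by
    refine norm_integral_le_of_norm_le
      (integrable_of_continuous_of_support hμ (by fun_prop)) ?_
    filter_upwards [this] with x hx
    rw [norm_mul, Real.norm_eq_abs, Real.norm_eq_abs, abs_of_nonneg (hw x)]
    exact mul_le_mul_of_nonneg_right (hf x hx) (hw x)
  rwa [integral_const_mul, hw1, mul_one] at h

lemma integral_X_pow_mul_eq_jacobiPow (hμ : μ (Set.Icc (-S) S)ᶜ = 0)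
    {a b : ℕ → ℝ} {p : ℕ → Polynomial ℝ}
    (hrec : ∀ l, Polynomial.X * p l = Polynomial.C (b (l + 1)) * p (l + 1) +
      Polynomial.C (a l) * p l + Polynomial.C (b l) * p (l - 1))
    (horth : ∀ i l, ∫ x, (p i).eval x * (p l).eval x ∂μ = if i = l then 1 else 0) (m i : ℕ) :
    ∫ x, x ^ m * (p i).eval x ^ 2 ∂μ = jacobiPow a b m i i := by
  let L : Polynomial ℝ →ₗ[ℝ] ℝ :=
    (integralMul hμ 1).comp (Polynomial.toContinuousMapAlgHom (R := ℝ)).toLinearMap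
  have hL : ∀ q, L q = ∫ x, q.eval x ∂μ := fun q => by simp [L, integralMul]
  rw [← functional_X_pow_mul_eq_jacobiPow hrec L (i + m + 1)
    (fun i l _ _ => by rw [hL, ← horth]; simp) m i i (by omega) (by omega), hL]
  simp [sq]

end Integral

theorem stmt18
    (μ : ℕ → MeasureTheory.Measure ℝ)
    (hfin : ∀ k, MeasureTheory.IsFiniteMeasure (μ k))
    (hsupp : ∃ R : ℝ, ∀ k, μ k ((Set.Icc (-R) R)ᶜ) = 0)
    (p : ℕ → ℕ → Polynomial ℝ) (ca cb : ℕ → ℕ → ℝ)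
    (hdeg : ∀ k l, (p k l).natDegree = l)
    (hlead : ∀ k l, 0 < (p k l).leadingCoeff)
    (horth : ∀ k l m, (∫ x, (p k l).eval x * (p k m).eval x ∂ (μ k)) = if l = m then 1 else 0)
    (hb0 : ∀ k, cb k 0 = 0)
    (hbpos : ∀ k l, 0 < cb k (l+1))
    (hrec : ∀ k l, Polynomial.X * p k l =
      Polynomial.C (cb k (l+1)) * p k (l+1) + Polynomial.C (ca k l) * p k l +
      Polynomial.C (cb k l) * p k (l-1))
    (xr : ℕ → ℕ → ℕ → ℝ)
    (hroot : ∀ k n j, 1 ≤ j → j ≤ n+1 → (p k (n+1)).eval (xr k (n+1) j) = 0)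
    (hrootlt : ∀ k n i j, 1 ≤ i → i < j → j ≤ n+1 → xr k (n+1) i < xr k (n+1) j)
    (σ : ℕ → ℕ → ℝ)
    (hσ0 : ∀ n k, k ≤ n → 0 ≤ σ n k)
    (hσ1 : ∀ n, ∑ k ∈ Finset.range (n+1), σ n k = 1)
    (hσ2 : ∀ k, Filter.Tendsto (fun n => σ n k) Filter.atTop (nhds 0))
    (hσdef : ∀ n k : ℕ, k ≤ n → σ n k = 1/((n:ℝ)+1))
    (hbdA : ∃ A : ℝ, ∀ k n, |ca k n| ≤ A)
    (hbdB : ∃ B : ℝ, ∀ k n, cb k n ≤ B)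
    (hNa : ∀ l : ℕ, 1 ≤ l → Filter.Tendsto
      (fun n => ∑ k ∈ Finset.range (n+1), σ n k * |ca (n-k) (k+l) - ca (n-k) k|)
      Filter.atTop (nhds 0))
    (hNb : ∀ l : ℕ, 1 ≤ l → Filter.Tendsto
      (fun n => ∑ k ∈ Finset.range (n+1), σ n k * |cb (n-k) (k+l) - cb (n-k) k|)
      Filter.atTop (nhds 0))
    (hNs : ∀ la lb : ℕ, Filter.Tendsto
      (fun n => ∑ k ∈ Finset.range (n+1), σ n k * (ca (n-k) k)^la * (cb (n-k) k)^lb)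
      Filter.atTop (nhds (if 1 ≤ la then 0 else Real.Gamma (3/2) * Real.Gamma ((lb:ℝ)/2+1) / (2^lb * Real.Gamma ((lb:ℝ)/2+3/2)))))
    :
    ∀ f : ℝ → ℝ, Continuous f → (∃ C : ℝ, ∀ x, |f x| ≤ C) →
      (Filter.Tendsto (fun n => ∑ k ∈ Finset.range (n+1),
          σ n k * ∫ x, f x * ((p (n-k) k).eval x)^2 ∂ (μ (n-k)))
          Filter.atTop
        (nhds ((1/2) * ∫ x in (-1:ℝ)..1, f x))) ∧
      (Filter.Tendsto (fun n => ∑ k ∈ Finset.range (n+1),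
          ∑ j ∈ Finset.Icc 1 (k+1), 2 * f (xr (n-k) (k+1) j) / (((n:ℝ)+1)*((n:ℝ)+2)))
        Filter.atTop
        (nhds ((1/2) * ∫ x in (-1:ℝ)..1, f x))) := by
  obtain ⟨R, hR⟩ := hsupp
  obtain ⟨A, hA⟩ := hbdA
  obtain ⟨B, hB⟩ := hbdB
  have hb : ∀ q i, 0 ≤ cb q i := fun q i => by
    rcases i with _ | i
    · exact (hb0 q).ge
    · exact (hbpos q i).le
  set S := max 1 (max R (B + A + B))
  have hS1 : 1 ≤ S := le_max_left _ _
  have hS : ∀ q i, cb q (i + 1) + |ca q i| + cb q i ≤ S := fun q i =>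
    (add_le_add_three (hB q _) (hA q i) (hB q i)).trans
      ((le_max_right _ _).trans (le_max_right _ _))
  have hμ : ∀ k, μ k (Set.Icc (-S) S)ᶜ = 0 := fun k => by
    have hRS : R ≤ S := (le_max_left _ _).trans (le_max_right _ _)
    exact measure_mono_null
      (Set.compl_subset_compl.mpr (Set.Icc_subset_Icc (neg_le_neg hRS) hRS)) (hR k)
  have hp0 : ∀ k y, (p k 0).eval y ≠ 0 := fun k y => by
    have h := hlead k 0
    rw [Polynomial.leadingCoeff, hdeg] at h
    rw [Polynomial.eq_C_of_natDegree_eq_zero (hdeg k 0), Polynomial.eval_C]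
    exact h.ne'
  have hmean : ∀ (u : ℕ → ℕ → ℝ) (n : ℕ), ∑ k ∈ range (n + 1), σ n k * u (n - k) k =
      (∑ k ∈ range (n + 1), u (n - k) k) / ((n : ℝ) + 1) := fun u n => by
    rw [sum_div]
    refine sum_congr rfl fun k hk => ?_
    rw [hσdef n k (Nat.lt_succ_iff.mp (mem_range.mp hk)), one_div_mul_eq_div]
  have hshift : ∀ c : ℕ → ℕ → ℝ, (∀ l : ℕ, 1 ≤ l → Tendsto
      (fun n => ∑ k ∈ range (n + 1), σ n k * |c (n - k) (k + l) - c (n - k) k|) atTop (𝓝 0)) →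
      ∀ l, MeanNull (fun q k => c q (k + l) - c q k) := fun c hc l => by
    rcases l with _ | l
    · simpa using MeanNull.zero
    · refine (hc (l + 1) (by omega)).congr fun n => ?_
      exact hmean (fun q k => |c q (k + (l + 1)) - c q k|) n
  have hb' := hshift cb hNb
  have ha : MeanNull ca := by
    refine MeanNull.of_sq ?_
    have h := hNs 2 0
    simp only [pow_zero, mul_one, one_le_two, if_true] at h
    refine h.congr fun n => ?_
    rw [hmean (fun q k => ca q k ^ 2) n]
    simp only [abs_sq]
  have ha' : ∀ i, MeanNull (fun q k => ca q (k + i)) := fun i => by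
    simpa using (hshift ca hNa i).add ha
  have hM : ∀ m, Tendsto (fun n : ℕ =>
      (∑ k ∈ range (n + 1), jacobiPow (ca (n - k)) (cb (n - k)) m k k) / ((n : ℝ) + 1)) atTop
      (𝓝 (1 / 2 * ∫ x in (-1 : ℝ)..1, x ^ m)) := fun m => by
    have hbS : ∀ q k, |cb q k| ≤ S := fun q k => by
      rw [abs_of_nonneg (hb q k)]
      have := hS q k
      have := hb q (k + 1)
      have := abs_nonneg (ca q k)
      linarith
    have hpow : ∀ j, MeanNull (fun q k => cb q (k + j) ^ m - cb q k ^ m) := fun j =>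
      (hb' j).pow_sub_pow (fun q k => hbS q (k + j)) hbS m
    have hnull : MeanNull (fun q k => jacobiPow (ca q) (cb q) m k k -
        walkCount m 0 * cb q k ^ m) := by
      refine MeanNull.of_shift (C := S ^ m + |walkCount m 0| * S ^ m) (fun q k => ?_) m ?_
      · refine (abs_sub _ _).trans (add_le_add (abs_jacobiPow_le (hb q) (hS q) m k k) ?_)
        rw [abs_mul, abs_pow]
        gcongr
        exact hbS q k
      · have h1 := meanNull_jacobiPow_sub hb hS ha' hb' m m m le_rfl
        have h2 := (hpow m).mul_of_abs_le (v := fun _ _ => -walkCount m 0)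
          (C := |walkCount m 0|) (fun _ _ => (abs_neg _).le)
        convert h1.add h2 using 3 with q k
        rw [sub_self]
        ring
    refine hnull.tendsto_mean ?_
    rw [← walkCount_zero_mul_gamma]
    have h := (hNs 0 m).const_mul (walkCount m 0)
    simp only [pow_zero, mul_one, nonpos_iff_eq_zero, one_ne_zero, if_false] at h
    refine h.congr fun n => ?_
    rw [hmean (fun q k => cb q k ^ m) n, ← mul_div_assoc, mul_sum]
  intro f hf _
  constructor
  · let w : ℕ → ℕ → C(ℝ, ℝ) := fun q k => (p q k).toContinuousMap ^ 2
    let Λ : ℕ → C(ℝ, ℝ) →ₗ[ℝ] ℝ := fun n =>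
      ∑ k ∈ range (n + 1), σ n k • integralMul (hμ (n - k)) (w (n - k) k)
    have hΛ : ∀ n g, Λ n g =
        ∑ k ∈ range (n + 1), σ n k * ∫ x, g x * ((p (n - k) k).eval x) ^ 2 ∂μ (n - k) :=
      fun n g => by simp [Λ, w, LinearMap.sum_apply, integralMul]
    have h := tendsto_uniform_of_moments hS1 Λ (fun n g ε hg => ?_) (fun m => ?_) ⟨f, hf⟩
    · exact h.congr fun n => hΛ n _
    · simp only [Λ, LinearMap.sum_apply, LinearMap.smul_apply, smul_eq_mul]
      calc _ ≤ ∑ k ∈ range (n + 1), σ n k * ε := by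
            refine (abs_sum_le_sum_abs _ _).trans (sum_le_sum fun k hk => ?_)
            have hσ := hσ0 n k (Nat.lt_succ_iff.mp (mem_range.mp hk))
            rw [abs_mul, abs_of_nonneg hσ]
            refine mul_le_mul_of_nonneg_left (abs_integralMul_le _ (fun x => ?_) ?_ g ε hg) hσ
            · simpa [w] using sq_nonneg _
            · simpa [w, sq] using horth (n - k) k k
        _ = ε := by rw [← sum_mul, hσ1, one_mul]
    · refine (hM m).congr fun n => ?_
      rw [hΛ, ← hmean (fun q k => jacobiPow (ca q) (cb q) m k k) n]
      refine sum_congr rfl fun k _ => ?_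
      rw [← integral_X_pow_mul_eq_jacobiPow (hμ (n - k)) (hrec _) (horth _)]
      simp
  · let Λ : ℕ → C(ℝ, ℝ) →ₗ[ℝ] ℝ := fun n => ∑ k ∈ range (n + 1), ∑ j ∈ Icc 1 (k + 1),
      (2 / (((n : ℝ) + 1) * ((n : ℝ) + 2))) •
        (ContinuousMap.evalCLM ℝ (xr (n - k) (k + 1) j) : C(ℝ, ℝ) →L[ℝ] ℝ).toLinearMap
    have hΛ : ∀ n g, Λ n g = ∑ k ∈ range (n + 1), ∑ j ∈ Icc 1 (k + 1),
        2 / (((n : ℝ) + 1) * ((n : ℝ) + 2)) * g (xr (n - k) (k + 1) j) :=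
      fun n g => by simp [Λ, LinearMap.sum_apply]
    have h := tendsto_uniform_of_moments hS1 Λ (fun n g ε hg => ?_) (fun m => ?_) ⟨f, hf⟩
    · refine h.congr fun n => ?_
      rw [hΛ]
      refine sum_congr rfl fun k _ => sum_congr rfl fun j _ => ?_
      exact div_mul_eq_mul_div _ _ _
    · rw [hΛ]
      calc _ ≤ ∑ k ∈ range (n + 1), ∑ j ∈ Icc 1 (k + 1),
            2 / (((n : ℝ) + 1) * ((n : ℝ) + 2)) * ε := by
            refine (abs_sum_le_sum_abs _ _).trans (sum_le_sum fun k _ => ?_)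
            refine (abs_sum_le_sum_abs _ _).trans (sum_le_sum fun j hj => ?_)
            rw [abs_mul, abs_of_pos (by positivity)]
            refine mul_le_mul_of_nonneg_left (hg _ (abs_le.mp ?_)) (by positivity)
            rw [mem_Icc] at hj
            exact abs_root_le (hb _) (hS _) (hrec _) (hp0 _ _) (hroot _ _ _ hj.1 hj.2)
        _ = ε := by
            simp only [sum_const, Nat.card_Icc, nsmul_eq_mul, Nat.add_sub_cancel, Nat.cast_add_one]
            rw [← sum_mul, sum_range_cast_add_one]
            field_simp
    · have hlim : Tendsto (fun n : ℕ => (m * (2 * S ^ m) * 2) * (1 / ((n : ℝ) + 1))) atTop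
          (𝓝 0) := by
        simpa using tendsto_one_div_add_atTop_nhds_zero_nat.const_mul (m * (2 * S ^ m) * 2 : ℝ)
      refine (tendsto_iff_of_dist (squeeze_zero (fun n => dist_nonneg) (fun n => ?_) hlim)).mp
        (tendsto_weighted_mean (hM m))
      have e1 : ∑ s ∈ range (n + 1), ((s : ℝ) + 1) *
          ((∑ k ∈ range (s + 1), jacobiPow (ca (s - k)) (cb (s - k)) m k k) / ((s : ℝ) + 1)) =
          ∑ k ∈ range (n + 1), ∑ i ∈ range (k + 1),
            jacobiPow (ca (n - k)) (cb (n - k)) m i i := by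
        rw [sum_antidiagonal_rearrange (fun q i => jacobiPow (ca q) (cb q) m i i) n]
        refine sum_congr rfl fun s _ => ?_
        field_simp
      rw [e1, hΛ, dist_comm, Real.dist_eq]
      simp_rw [← mul_sum]
      rw [mul_comm, ← sub_mul, ← sum_sub_distrib, abs_mul,
        abs_of_pos (by positivity : (0 : ℝ) < 2 / (((n : ℝ) + 1) * ((n : ℝ) + 2)))]
      have e2 : |∑ k ∈ range (n + 1), (∑ j ∈ Icc 1 (k + 1),
          (ContinuousMap.id ℝ ^ m) (xr (n - k) (k + 1) j) -
          ∑ i ∈ range (k + 1), jacobiPow (ca (n - k)) (cb (n - k)) m i i)| ≤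
          (n + 1) * (m * (2 * S ^ m)) := by
        refine (abs_sum_le_sum_abs _ _).trans ?_
        calc _ ≤ ∑ k ∈ range (n + 1), (m * (2 * S ^ m) : ℝ) := sum_le_sum fun k _ => ?_
          _ = _ := by simp
        have hinj : Function.Injective
            (fun j : Fin (k + 1) => xr (n - k) (k + 1) (j + 1)) := by
          refine StrictMono.injective fun i j hij => ?_
          have := i.2
          have := j.2
          exact hrootlt _ _ _ _ (by omega) (by simpa using hij) (by omega)
        have e3 := abs_sum_root_pow_sub_le (hb (n - k)) (hS (n - k)) (hrec (n - k)) hinj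
          (hp0 (n - k)) (fun j => hroot _ _ _ (by omega) (by have := j.2; omega)) m
        rw [Fin.sum_univ_eq_sum_range (fun j => xr (n - k) (k + 1) (j + 1) ^ m),
          range_eq_Ico, sum_Ico_add' (fun j => xr (n - k) (k + 1) j ^ m)] at e3
        simpa [range_eq_Ico, Ico_add_one_right_eq_Icc] using e3
      calc _ ≤ (n + 1) * (m * (2 * S ^ m)) * (2 / (((n : ℝ) + 1) * ((n : ℝ) + 2))) := by gcongr
        _ = m * (2 * S ^ m) * 2 * (1 / ((n : ℝ) + 2)) := by field_simp
        _ ≤ _ := by gcongr; norm_num
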